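/- arXiv:1101.3267 — 2 statements merged into one kernel-verified Lean document; each statement's English description precedes it below -/
import Mathlib

section
/- Let A be an integer (r,s)×t bimatrix with Graver complexity g(A), and let Z(A) be the set of sums of at most g(A) elements of the Graver basis 𝒢(A₂). Then for every positive integer n, every element g = (g¹,…,gⁿ) of the Graver basis 𝒢(A⁽ⁿ⁾) of the n-fold product, and every subset I ⊆ {1,…,n}, the partial brick sum Σ_{i∈I} gⁱ belongs to Z(A). -/
open Matrix

/-- The conformal (sign-compatible) partial order `x ⊑ y` on integer vectors:
`x k * y k ≥ 0` and `|x k| ≤ |y k|` for every coordinate `k`. -/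
def ConformalLe {ν : Type*} (x y : ν → ℤ) : Prop :=
  ∀ k, 0 ≤ x k * y k ∧ |x k| ≤ |y k|

/-- The Graver basis of an integer matrix `A`: the set of `⊑`-minimal elements of
`{x : A x = 0, x ≠ 0}`. -/
def GraverBasis {μ ν : Type*} [Fintype ν] (A : Matrix μ ν ℤ) : Set (ν → ℤ) :=
  {x | A.mulVec x = 0 ∧ x ≠ 0 ∧
    ∀ y, A.mulVec y = 0 → y ≠ 0 → ConformalLe y x → y = x}

/-- The `ι`-fold product of the bimatrix with blocks `A1` (first block, `r × τ`) and
`A2` (second block, `s × τ`): the first `r` rows are `(A1 A1 ⋯ A1)` and the remaining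
rows form a block-diagonal matrix with a copy of `A2` for each index in `ι`. -/
def nFold {r s : ℕ} {τ : Type*} (A1 : Matrix (Fin r) τ ℤ) (A2 : Matrix (Fin s) τ ℤ)
    (ι : Type*) [DecidableEq ι] : Matrix (Fin r ⊕ ι × Fin s) (ι × τ) ℤ :=
  Matrix.of fun i jt =>
    match i with
    | Sum.inl a => A1 a jt.2
    | Sum.inr (k, c) => if jt.1 = k then A2 c jt.2 else 0

/-- The `i`-th brick of a vector indexed by `ι × τ`. -/
def brick {ι τ : Type*} (x : ι × τ → ℤ) (i : ι) : τ → ℤ := fun j => x (i, j)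

/-- The Graver complexity of the bimatrix `(A1, A2)`: the largest number of nonzero
bricks appearing in any element of the Graver basis of any `n`-fold product. -/
noncomputable def graverComplexity {r s t : ℕ} (A1 : Matrix (Fin r) (Fin t) ℤ)
    (A2 : Matrix (Fin s) (Fin t) ℤ) : ℕ :=
  sSup {k : ℕ | ∃ (n : ℕ) (g : Fin n × Fin t → ℤ),
    g ∈ GraverBasis (nFold A1 A2 (Fin n)) ∧
    k = {i : Fin n | brick g i ≠ 0}.ncard}

/-- `Z(A)`: the set of all vectors in `ℤ^t` that are sums of at most `g(A)` elements
of the Graver basis of `A2`. -/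
noncomputable def ZSet {r s t : ℕ} (A1 : Matrix (Fin r) (Fin t) ℤ)
    (A2 : Matrix (Fin s) (Fin t) ℤ) : Set (Fin t → ℤ) :=
  {z | ∃ L : List (Fin t → ℤ), L.length ≤ graverComplexity A1 A2 ∧
    (∀ h ∈ L, h ∈ GraverBasis A2) ∧ z = L.sum}

theorem sign_conformal_iff {a b : ℤ} :
    (0 ≤ a * b ∧ |a| ≤ |b|) ↔ (0 ≤ a ∧ a ≤ b) ∨ (b ≤ a ∧ a ≤ 0) := by
  constructor
  · rintro ⟨h1, h2⟩
    rcases le_total 0 a with ha | ha <;> rcases le_total 0 b with hb | hb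
    · rw [abs_of_nonneg ha, abs_of_nonneg hb] at h2
      exact Or.inl ⟨ha, h2⟩
    · rw [abs_of_nonneg ha, abs_of_nonpos hb] at h2
      have : a = 0 ∨ b = 0 := by
        by_contra! h
        have : a * b < 0 := mul_neg_of_pos_of_neg (by omega) (by omega)
        omega
      omega
    · rw [abs_of_nonpos ha, abs_of_nonneg hb] at h2
      have : a = 0 ∨ b = 0 := by
        by_contra! h
        have : a * b < 0 := mul_neg_of_neg_of_pos (by omega) (by omega)
        omega
      omega
    · rw [abs_of_nonpos ha, abs_of_nonpos hb] at h2
      exact Or.inr ⟨by omega, ha⟩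
  · rintro (⟨h1, h2⟩ | ⟨h1, h2⟩)
    · exact ⟨mul_nonneg h1 (h1.trans h2), abs_le_abs_of_nonneg h1 h2⟩
    · exact ⟨mul_nonneg_of_nonpos_of_nonpos h2 (h1.trans h2), abs_le_abs_of_nonpos h2 h1⟩

theorem conformalLe_iff {ν : Type*} {x y : ν → ℤ} :
    ConformalLe x y ↔ ∀ k, (0 ≤ x k ∧ x k ≤ y k) ∨ (y k ≤ x k ∧ x k ≤ 0) :=
  forall_congr' fun _ => sign_conformal_iff

theorem ConformalLe.refl {ν : Type*} (x : ν → ℤ) : ConformalLe x x :=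
  fun _ => ⟨mul_self_nonneg _, le_rfl⟩

theorem ConformalLe.trans {ν : Type*} {x y z : ν → ℤ} (h : ConformalLe x y)
    (h' : ConformalLe y z) : ConformalLe x z := by
  rw [conformalLe_iff] at *
  intro k
  have := h k
  have := h' k
  omega

theorem ConformalLe.sub {ν : Type*} {x y : ν → ℤ} (h : ConformalLe y x) :
    ConformalLe (x - y) x := by
  rw [conformalLe_iff] at *
  intro k
  have := h k
  simp only [Pi.sub_apply]
  omega

theorem ConformalLe.sum_natAbs_lt {ν : Type*} [Fintype ν] {x y : ν → ℤ}
    (h : ConformalLe y x) (hne : y ≠ x) : ∑ k, (y k).natAbs < ∑ k, (x k).natAbs := by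
  rw [conformalLe_iff] at h
  obtain ⟨k, hk⟩ := Function.ne_iff.mp hne
  refine Finset.sum_lt_sum (fun i _ => ?_) ⟨k, Finset.mem_univ _, ?_⟩
  · have := h i
    omega
  · have := h k
    omega

/-- Every integer kernel vector is a conformal sum of Graver basis elements. -/
theorem exists_conformal_decomposition {μ ν : Type*} [Fintype ν] (A : Matrix μ ν ℤ)
    (x : ν → ℤ) (hx : A.mulVec x = 0) :
    ∃ L : List (ν → ℤ), (∀ h ∈ L, h ∈ GraverBasis A ∧ ConformalLe h x) ∧ L.sum = x := by
  induction hn : ∑ k, (x k).natAbs using Nat.strong_induction_on generalizing x with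
  | _ n ih =>
    subst hn
    by_cases h0 : x = 0
    · exact ⟨[], by simp, by simp [h0]⟩
    by_cases hG : x ∈ GraverBasis A
    · exact ⟨[x], by simp [hG, ConformalLe.refl], by simp⟩
    obtain ⟨y, hy, hy0, hyx, hne⟩ :
        ∃ y, A.mulVec y = 0 ∧ y ≠ 0 ∧ ConformalLe y x ∧ y ≠ x := by
      by_contra! h
      exact hG ⟨hx, h0, h⟩
    obtain ⟨L₁, h₁, s₁⟩ := ih _ (hyx.sum_natAbs_lt hne) y hy rfl
    obtain ⟨L₂, h₂, s₂⟩ := ih _ (hyx.sub.sum_natAbs_lt (by simpa using hy0)) (x - y)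
      (by rw [Matrix.mulVec_sub, hx, hy, sub_zero]) rfl
    refine ⟨L₁ ++ L₂, fun h hh => ?_, by simp [s₁, s₂]⟩
    rcases List.mem_append.mp hh with hh | hh
    · exact ⟨(h₁ h hh).1, (h₁ h hh).2.trans hyx⟩
    · exact ⟨(h₂ h hh).1, (h₂ h hh).2.trans hyx.sub⟩

/-- The Graver basis of an integer matrix is finite. -/
theorem graverBasis_finite {μ ν : Type*} [Fintype ν] (A : Matrix μ ν ℤ) :
    (GraverBasis A).Finite := by
  by_contra hinf
  have : Infinite (GraverBasis A) := Set.infinite_coe_iff.mpr hinf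
  let e := Infinite.natEmbedding (GraverBasis A)
  obtain ⟨m, n, hmn, hle⟩ := wellQuasiOrdered_le
    (fun (i : ℕ) (k : ν) => (((e i).1 k).toNat, (-(e i).1 k).toNat))
  have hc : ConformalLe (e m).1 (e n).1 := by
    rw [conformalLe_iff]
    intro k
    have h := hle k
    simp only [Prod.mk_le_mk] at h
    omega
  have := (e n).2.2.2 _ (e m).2.1 (e m).2.2.1 hc
  exact hmn.ne (e.injective (Subtype.ext this))

theorem nFold_mulVec_eq_zero_iff {r s : ℕ} {ι τ : Type*} [Fintype ι] [DecidableEq ι] [Fintype τ]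
    (A1 : Matrix (Fin r) τ ℤ) (A2 : Matrix (Fin s) τ ℤ) (x : ι × τ → ℤ) :
    (nFold A1 A2 ι).mulVec x = 0 ↔
      A1.mulVec (∑ i, brick x i) = 0 ∧ ∀ i, A2.mulVec (brick x i) = 0 := by
  have h1 (a : Fin r) : (nFold A1 A2 ι).mulVec x (Sum.inl a) = A1.mulVec (∑ i, brick x i) a := by
    simp only [Matrix.mulVec, dotProduct, nFold, Matrix.of_apply, Fintype.sum_prod_type,
      Finset.sum_apply, brick, Finset.mul_sum]
    exact Finset.sum_comm
  have h2 (i : ι) (c : Fin s) :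
      (nFold A1 A2 ι).mulVec x (Sum.inr (i, c)) = A2.mulVec (brick x i) c := by
    simp only [Matrix.mulVec, dotProduct, nFold, Matrix.of_apply, Fintype.sum_prod_type, brick]
    rw [Finset.sum_eq_single i]
    · simp
    · intro b _ hb
      simp [hb]
    · simp
  constructor
  · intro h
    refine ⟨funext fun a => ?_, fun i => funext fun c => ?_⟩
    · rw [← h1, h]; rfl
    · rw [← h2, h]; rfl
  · rintro ⟨ha, hb⟩
    funext k
    rcases k with a | ⟨i, c⟩
    · rw [h1, ha]; rfl
    · rw [h2, hb]; rfl

theorem sum_sign_conformal {ι : Type*} (S : Finset ι) (y z : ι → ℤ) (b : ℤ)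
    (hy : ∀ p ∈ S, (0 ≤ y p ∧ y p ≤ z p) ∨ (z p ≤ y p ∧ y p ≤ 0))
    (hz : ∀ p ∈ S, (0 ≤ z p ∧ z p ≤ b) ∨ (b ≤ z p ∧ z p ≤ 0)) (hb : ∑ p ∈ S, z p = b) :
    ((0 ≤ ∑ p ∈ S, y p ∧ ∑ p ∈ S, y p ≤ b) ∨ (b ≤ ∑ p ∈ S, y p ∧ ∑ p ∈ S, y p ≤ 0)) ∧
    (∑ p ∈ S, y p = 0 → ∀ p ∈ S, y p = 0) ∧ (∑ p ∈ S, y p = b → ∀ p ∈ S, y p = z p) := by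
  rcases le_total 0 b with h | h
  · have h0 : ∀ p ∈ S, 0 ≤ y p := fun p hp => by
      have := hy p hp
      have := hz p hp
      omega
    have h1 : ∀ p ∈ S, y p ≤ z p := fun p hp => by
      have := hy p hp
      have := hz p hp
      omega
    refine ⟨Or.inl ⟨Finset.sum_nonneg h0, hb ▸ Finset.sum_le_sum h1⟩, fun h => ?_, fun h => ?_⟩
    · exact (Finset.sum_eq_zero_iff_of_nonneg h0).mp h
    · exact (Finset.sum_eq_sum_iff_of_le h1).mp (h.trans hb.symm)
  · have h0 : ∀ p ∈ S, y p ≤ 0 := fun p hp => by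
      have := hy p hp
      have := hz p hp
      omega
    have h1 : ∀ p ∈ S, z p ≤ y p := fun p hp => by
      have := hy p hp
      have := hz p hp
      omega
    refine ⟨Or.inr ⟨hb ▸ Finset.sum_le_sum h1, Finset.sum_nonpos h0⟩, fun h => ?_, fun h => ?_⟩
    · exact (Finset.sum_eq_zero_iff_of_nonpos h0).mp h
    · exact fun p hp => ((Finset.sum_eq_sum_iff_of_le h1).mp (hb.trans h.symm) p hp).symm

/-- Splitting the bricks of a Graver basis element conformally into kernel vectors of the second
block yields a Graver basis element of a larger `n`-fold product. -/
theorem expansion_mem_graverBasis {r s : ℕ} {ι κ τ : Type*} [Fintype ι] [DecidableEq ι]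
    [Fintype κ] [DecidableEq κ] [Fintype τ]
    (A1 : Matrix (Fin r) τ ℤ) (A2 : Matrix (Fin s) τ ℤ) (g : ι × τ → ℤ)
    (hg : g ∈ GraverBasis (nFold A1 A2 ι)) (π : κ → ι) (H : κ → τ → ℤ)
    (hker : ∀ p, A2.mulVec (H p) = 0) (hconf : ∀ p, ConformalLe (H p) (brick g (π p)))
    (hsum : ∀ i, ∑ p with π p = i, H p = brick g i) :
    (fun q : κ × τ => H q.1 q.2) ∈ GraverBasis (nFold A1 A2 κ) := by
  obtain ⟨hg1, hg2, hg3⟩ := hg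
  rw [nFold_mulVec_eq_zero_iff] at hg1
  refine ⟨?_, ?_, ?_⟩
  · rw [nFold_mulVec_eq_zero_iff]
    refine ⟨?_, hker⟩
    have : ∑ p, brick (fun q : κ × τ => H q.1 q.2) p = ∑ i, brick g i := by
      rw [← Finset.sum_fiberwise Finset.univ π]
      exact Finset.sum_congr rfl fun i _ => hsum i
    rw [this, hg1.1]
  · intro h0
    apply hg2
    funext ⟨i, j⟩
    change brick g i j = 0
    rw [← hsum i, Finset.sum_apply]
    exact Finset.sum_eq_zero fun p _ => congrFun h0 (p, j)
  · intro y hy hy0 hyH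
    rw [nFold_mulVec_eq_zero_iff] at hy
    have key (i : ι) (j : τ) := sum_sign_conformal (Finset.univ.filter (π · = i))
      (fun p => y (p, j)) (fun p => H p j) (g (i, j))
      (fun p _ => conformalLe_iff.mp hyH (p, j))
      (fun p hp => by
        have := conformalLe_iff.mp (hconf p) j
        rw [(Finset.mem_filter.mp hp).2] at this
        exact this)
      (by
        have := congrFun (hsum i) j
        rwa [Finset.sum_apply] at this)
    let y' : ι × τ → ℤ := fun q => ∑ p with π p = q.1, y (p, q.2)
    have hbrick (i : ι) : brick y' i = ∑ p with π p = i, brick y p := by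
      funext j
      rw [Finset.sum_apply]
      rfl
    have hy'g : y' = g := by
      refine hg3 y' ?_ ?_ (conformalLe_iff.mpr fun q => (key q.1 q.2).1)
      · rw [nFold_mulVec_eq_zero_iff]
        refine ⟨?_, fun i => ?_⟩
        · simp only [hbrick]
          rw [Finset.sum_fiberwise Finset.univ π]
          exact hy.1
        · rw [hbrick, ← Matrix.mulVecLin_apply, map_sum]
          exact Finset.sum_eq_zero fun p _ => hy.2 p
      · intro h0
        apply hy0
        funext ⟨p, j⟩
        exact (key (π p) j).2.1 (congrFun h0 (π p, j)) p (by simp)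
    funext ⟨p, j⟩
    exact (key (π p) j).2.2 (congrFun hy'g (π p, j)) p (by simp)

theorem exists_expansion {r s n t : ℕ} (A1 : Matrix (Fin r) (Fin t) ℤ)
    (A2 : Matrix (Fin s) (Fin t) ℤ) (g : Fin n × Fin t → ℤ)
    (hg : g ∈ GraverBasis (nFold A1 A2 (Fin n))) :
    ∃ (N : ℕ) (π : Fin N → Fin n) (H : Fin N → Fin t → ℤ),
      (∀ p, H p ∈ GraverBasis A2) ∧ (∀ i, ∑ p with π p = i, H p = brick g i) ∧
      (fun q : Fin N × Fin t => H q.1 q.2) ∈ GraverBasis (nFold A1 A2 (Fin N)) := by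
  have hk := ((nFold_mulVec_eq_zero_iff A1 A2 g).mp hg.1).2
  choose L hL hLs using fun i => exists_conformal_decomposition A2 (brick g i) (hk i)
  let e := Fintype.equivFin (Σ i, Fin (L i).length)
  let π : Fin (Fintype.card (Σ i, Fin (L i).length)) → Fin n := fun p => (e.symm p).1
  let H : Fin (Fintype.card (Σ i, Fin (L i).length)) → Fin t → ℤ :=
    fun p => (L (e.symm p).1).get (e.symm p).2
  have hH (p) := hL (e.symm p).1 (H p) (List.get_mem _ _)
  have hs (i) : ∑ p with π p = i, H p = brick g i := by
    rw [Finset.sum_filter]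
    rw [e.symm.sum_comp (fun q : Σ i, Fin (L i).length => if q.1 = i then (L q.1).get q.2 else 0),
      Fintype.sum_sigma, Finset.sum_eq_single i]
    · simp only [if_true]
      rw [← hLs i]
      conv_rhs => rw [← List.ofFn_get (L i)]
      rw [List.sum_ofFn]
    · intro b _ hb
      simp [hb]
    · simp
  exact ⟨_, π, H, fun p => (hH p).1, hs,
    expansion_mem_graverBasis A1 A2 g hg π H (fun p => (hH p).1.1) (fun p => (hH p).2) hs⟩

/-- The multiplicity vector of a Graver basis element whose bricks all lie in the Graver basis of
the second block is a minimal nonzero natural solution of the aggregated linear system. -/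
theorem minimal_brick_multiplicity {r s t N : ℕ} (A1 : Matrix (Fin r) (Fin t) ℤ)
    (A2 : Matrix (Fin s) (Fin t) ℤ) [Fintype (GraverBasis A2)]
    (H : Fin N → GraverBasis A2)
    (hH : (fun q : Fin N × Fin t => (H q.1).1 q.2) ∈ GraverBasis (nFold A1 A2 (Fin N))) :
    Minimal (fun l : GraverBasis A2 → ℕ => l ≠ 0 ∧ A1.mulVec (∑ h, l h • h.1) = 0)
      (fun h => (Finset.univ.filter (H · = h)).card) := by
  classical
  obtain ⟨h1, h2, h3⟩ := hH
  rw [nFold_mulVec_eq_zero_iff] at h1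
  have hcount (y : Fin N → Fin t → ℤ) (J : GraverBasis A2 → Finset (Fin N))
      (hJ : ∀ h, J h ⊆ Finset.univ.filter (H · = h))
      (hy : ∀ p, y p = if p ∈ J (H p) then (H p).1 else 0) :
      ∑ p, y p = ∑ h, (J h).card • h.1 := by
    rw [← Finset.sum_fiberwise Finset.univ H]
    refine Finset.sum_congr rfl fun h _ => ?_
    rw [← Finset.sum_const, ← Finset.sum_subset (hJ h)]
    · refine Finset.sum_congr rfl fun p hp => ?_
      have hp' := (Finset.mem_filter.mp (hJ h hp)).2
      rw [hy, hp', if_pos hp]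
    · intro p hp hn
      rw [hy, (Finset.mem_filter.mp hp).2, if_neg hn]
  refine ⟨⟨?_, ?_⟩, ?_⟩
  · intro h0
    apply h2
    funext ⟨p, j⟩
    have := congrFun h0 (H p)
    simp only [Pi.zero_apply, Finset.card_eq_zero] at this
    exact absurd this (Finset.ne_empty_of_mem (a := p) (by simp))
  · rw [← hcount (fun p => (H p).1) (fun h => Finset.univ.filter (H · = h))
      (fun _ => subset_rfl) (by simp)]
    exact h1.1
  · rintro l ⟨hl0, hl⟩ hle
    choose J hJ hJc using fun h => Finset.exists_subset_card_eq (hle h)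
    let y : Fin N → Fin t → ℤ := fun p => if p ∈ J (H p) then (H p).1 else 0
    have hyH : (fun q : Fin N × Fin t => y q.1 q.2) = fun q => (H q.1).1 q.2 := by
      refine h3 _ ?_ ?_ ?_
      · rw [nFold_mulVec_eq_zero_iff]
        constructor
        · have : ∑ p, brick (fun q : Fin N × Fin t => y q.1 q.2) p = ∑ h, (J h).card • h.1 :=
            hcount y J hJ fun _ => rfl
          rw [this]
          simpa only [hJc] using hl
        · intro p
          change A2.mulVec (y p) = 0
          by_cases hp : p ∈ J (H p)
          · simp only [y, if_pos hp]
            exact (H p).2.1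
          · simp only [y, if_neg hp, Matrix.mulVec_zero]
      · intro h0
        obtain ⟨h, hh⟩ := Function.ne_iff.mp hl0
        rw [← hJc h] at hh
        obtain ⟨p, hp⟩ := Finset.card_ne_zero.mp hh
        have hp' := (Finset.mem_filter.mp (hJ h hp)).2
        apply h.2.2.1
        funext j
        have := congrFun h0 (p, j)
        simp only [y, hp', if_pos hp] at this
        exact this
      · rw [conformalLe_iff]
        rintro ⟨p, j⟩
        simp only [y]
        split_ifs
        · omega
        · simp only [Pi.zero_apply]
          omega
    intro h
    change _ ≤ l h
    rw [← hJc h]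
    refine Finset.card_le_card fun p hp => ?_
    obtain rfl := (Finset.mem_filter.mp hp).2
    by_contra hn
    apply (H p).2.2.1
    funext j
    have := congrFun hyH (p, j)
    simp only [y, if_neg hn] at this
    exact this.symm

/-- The number of bricks of a Graver basis element with all bricks in the Graver basis of the
second block is uniformly bounded. -/
theorem exists_bound_of_bricks_mem {r s t : ℕ} (A1 : Matrix (Fin r) (Fin t) ℤ)
    (A2 : Matrix (Fin s) (Fin t) ℤ) :
    ∃ B : ℕ, ∀ (N : ℕ) (H : Fin N → Fin t → ℤ), (∀ p, H p ∈ GraverBasis A2) →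
      (fun q : Fin N × Fin t => H q.1 q.2) ∈ GraverBasis (nFold A1 A2 (Fin N)) → N ≤ B := by
  classical
  have : Fintype (GraverBasis A2) := (graverBasis_finite A2).fintype
  have hfin : {l | Minimal
      (fun l : GraverBasis A2 → ℕ => l ≠ 0 ∧ A1.mulVec (∑ h, l h • h.1) = 0) l}.Finite := by
    by_contra hinf
    have := Set.infinite_coe_iff.mpr hinf
    let e := Infinite.natEmbedding {l | Minimal
      (fun l : GraverBasis A2 → ℕ => l ≠ 0 ∧ A1.mulVec (∑ h, l h • h.1) = 0) l}
    obtain ⟨m, n, hmn, hle⟩ := wellQuasiOrdered_le (fun i => (e i).1)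
    have hm := Set.mem_ofPred_eq ▸ (e m).2
    have hn := Set.mem_ofPred_eq ▸ (e n).2
    exact hmn.ne (e.injective (Subtype.ext (hn.eq_of_le hm.prop hle)))
  obtain ⟨B, hB⟩ := (hfin.image fun l => ∑ h, l h).bddAbove
  refine ⟨B, fun N H hHG hH => ?_⟩
  have := hB ⟨_, minimal_brick_multiplicity A1 A2 (fun p => ⟨H p, hHG p⟩) hH, rfl⟩
  simp only at this
  rwa [← Finset.card_eq_sum_card_fiberwise (fun _ _ => Finset.mem_coe.mpr (Finset.mem_univ _)),
    Finset.card_univ, Fintype.card_fin] at this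

/-- The set of numbers of nonzero bricks defining the Graver complexity is bounded. -/
theorem bddAbove_nonzero_bricks {r s t : ℕ} (A1 : Matrix (Fin r) (Fin t) ℤ)
    (A2 : Matrix (Fin s) (Fin t) ℤ) :
    BddAbove {k : ℕ | ∃ (n : ℕ) (g : Fin n × Fin t → ℤ),
      g ∈ GraverBasis (nFold A1 A2 (Fin n)) ∧ k = {i : Fin n | brick g i ≠ 0}.ncard} := by
  classical
  obtain ⟨B, hB⟩ := exists_bound_of_bricks_mem A1 A2
  refine ⟨B, ?_⟩
  rintro k ⟨n, g, hg, rfl⟩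
  obtain ⟨N, π, H, hHG, hs, hH⟩ := exists_expansion A1 A2 g hg
  refine le_trans ?_ (hB N H hHG hH)
  have hsub : {i : Fin n | brick g i ≠ 0} ⊆ Set.range π := by
    intro i hi
    by_contra hn
    apply hi
    rw [← hs i, Finset.filter_eq_empty_iff.mpr (fun p _ hp => hn ⟨p, hp⟩), Finset.sum_empty]
  calc {i : Fin n | brick g i ≠ 0}.ncard ≤ (Set.range π).ncard := Set.ncard_le_ncard hsub
    _ = (π '' Set.univ).ncard := by rw [Set.image_univ]
    _ ≤ (Set.univ : Set (Fin N)).ncard := Set.ncard_image_le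
    _ = N := by simp [Set.ncard_univ]

/-- For an integer `(r,s) × t` bimatrix `A`, every positive `n`,
every element `g` of the Graver basis of the `n`-fold product, and every subset `I`
of the brick indices, the partial brick sum `∑ i ∈ I, gⁱ` lies in `Z(A)`. -/
theorem partial_brick_sum_mem_ZSet {r s t : ℕ} (A1 : Matrix (Fin r) (Fin t) ℤ)
    (A2 : Matrix (Fin s) (Fin t) ℤ) (n : ℕ) (hn : 0 < n)
    (g : Fin n × Fin t → ℤ) (hg : g ∈ GraverBasis (nFold A1 A2 (Fin n)))
    (I : Finset (Fin n)) :
    (fun j => ∑ i ∈ I, g (i, j)) ∈ ZSet A1 A2 := by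
  obtain ⟨N, π, H, hHG, hs, hH⟩ := exists_expansion A1 A2 g hg
  have hN : N ≤ graverComplexity A1 A2 := by
    refine le_csSup (bddAbove_nonzero_bricks A1 A2) ⟨N, _, hH, ?_⟩
    have : {p : Fin N | brick (fun q : Fin N × Fin t => H q.1 q.2) p ≠ 0} = Set.univ :=
      Set.eq_univ_of_forall fun p => (hHG p).2.1
    rw [this]
    simp [Set.ncard_univ]
  refine ⟨((Finset.univ.filter (π · ∈ I)).toList.map H), ?_, ?_, ?_⟩
  · rw [List.length_map, Finset.length_toList]
    exact ((Finset.card_le_univ _).trans_eq (Fintype.card_fin N)).trans hN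
  · intro h hh
    obtain ⟨p, -, rfl⟩ := List.mem_map.mp hh
    exact hHG p
  · have hI : (fun j => ∑ i ∈ I, g (i, j)) = ∑ i ∈ I, brick g i := by
      funext j
      rw [Finset.sum_apply]
      rfl
    rw [hI, Finset.sum_map_toList, ← Finset.sum_fiberwise_of_maps_to (t := I) (g := π)
      (fun p hp => (Finset.mem_filter.mp hp).2)]
    refine Finset.sum_congr rfl fun i hi => ?_
    rw [← hs i, Finset.filter_filter]
    refine Finset.sum_congr (Finset.filter_congr fun p _ => ?_) fun _ _ => rfl
    exact ⟨fun h => ⟨h ▸ hi, h⟩, fun h => h.2⟩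
end

section
/- Let A be an integer (r,s)×t bimatrix with nt ≥ 2, let x be a feasible point of the n-fold integer program with objective w and finite bounds l, u, and let x* be an optimal solution. Suppose γg is a Graver-best step for x, that is: γ is a positive integer, A⁽ⁿ⁾g = 0, x + γg is feasible, w·(γg) ≤ 0, and w·(x+γg) ≤ w·(x+γ̄ḡ) for every positive integer γ̄ and every ḡ ∈ 𝒢(A⁽ⁿ⁾) with x + γ̄ḡ feasible. Then w·(x+γg) − w·x ≤ (w·x* − w·x)/(2(nt−1)). -/
open Matrix

section Caratheodory

open Finset

/-- For a nonnegative vector in a subgroup of `ℤ^ν`, subtracting minimal positive elements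
exhausts it. -/
theorem mem_span_minimal {ν : Type*} [Fintype ν] (M : AddSubgroup (ν → ℤ)) (d : ν → ℤ) :
    ∀ z ∈ M, 0 ≤ z → z ≤ d →
      z ∈ Submodule.span ℕ {h | Minimal (fun h => h ∈ M ∧ 0 < h) h ∧ h ≤ d} := by
  classical
  intro z
  induction hm : (∑ k, z k).toNat using Nat.strong_induction_on generalizing z with
  | _ m ih =>
    intro hzM hz0 hzd
    rcases hz0.eq_or_lt with rfl | hz
    · exact Submodule.zero_mem _
    have hfin : {h : ν → ℤ | (h ∈ M ∧ 0 < h) ∧ h ≤ z}.Finite :=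
      (Set.finite_Icc 0 z).subset fun h hh => ⟨hh.1.2.le, hh.2⟩
    obtain ⟨h, hhz, hmin⟩ := hfin.exists_le_minimal (a := z) ⟨⟨hzM, hz⟩, le_rfl⟩
    have hmin' : Minimal (fun h => h ∈ M ∧ 0 < h) h :=
      ⟨hmin.prop.1, fun y hy hyh => hmin.le_of_le ⟨hy, hyh.trans hhz⟩ hyh⟩
    have hsum : 0 < ∑ k, h k := by
      obtain ⟨h0, k, hk⟩ := Pi.lt_def.1 hmin'.prop.2
      exact sum_pos' (fun i _ => h0 i) ⟨k, mem_univ _, hk⟩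
    have hle : ∑ k, h k ≤ ∑ k, z k := sum_le_sum fun k _ => hhz k
    have key := ih (∑ k, (z - h) k).toNat (by
      simp only [Pi.sub_apply, sum_sub_distrib]; omega) (z - h) rfl
      (M.sub_mem hzM hmin'.prop.1) (sub_nonneg.2 hhz)
      ((sub_le_self _ hmin'.prop.2.le).trans hzd)
    have := Submodule.add_mem _ key (Submodule.subset_span
      (show h ∈ {h | Minimal (fun h => h ∈ M ∧ 0 < h) h ∧ h ≤ d} from ⟨hmin', hhz.trans hzd⟩))
    simpa using this

/-- No feasible direction at `c` in the polyhedron `{c ≥ 0, ∑ c i • v i = d}` increases `∑ c i`,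
and none preserving `∑ c i` decreases `∑ c i * q i`. -/
def LexOptimal {ι ν : Type*} [Fintype ι] (v : ι → ν → ℝ) (q : ι → ℝ) (c : ι → ℝ) : Prop :=
  ∀ a : ι → ℝ, ∑ i, a i • v i = 0 → (∀ i, c i = 0 → 0 ≤ a i) →
    ∑ i, a i ≤ 0 ∧ (∑ i, a i = 0 → 0 ≤ ∑ i, a i * q i)

theorem exists_pos_add_smul_nonneg {ι : Type*} [Fintype ι] {c a : ι → ℝ} (hc : 0 ≤ c)
    (ha : ∀ i, c i = 0 → 0 ≤ a i) : ∃ ε : ℝ, 0 < ε ∧ 0 ≤ c + ε • a := by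
  have h : ∀ i, ∀ᶠ ε : ℝ in nhdsWithin 0 (Set.Ioi 0), 0 ≤ c i + ε * a i := by
    intro i
    rcases (hc i).eq_or_lt with h0 | h0
    · filter_upwards [self_mem_nhdsWithin] with ε hε
      have := mul_nonneg (le_of_lt hε) (ha i h0.symm)
      rw [← h0]; simpa using this
    · have : Filter.Tendsto (fun ε : ℝ => c i + ε * a i) (nhds 0) (nhds (c i + 0 * a i)) :=
        (Continuous.tendsto (by fun_prop) 0)
      rw [zero_mul, add_zero] at this
      exact ((this.mono_left nhdsWithin_le_nhds).eventually (lt_mem_nhds h0)).mono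
        fun _ h => h.le
  obtain ⟨ε, h1, h2⟩ := ((Filter.eventually_all.2 h).and self_mem_nhdsWithin).exists
  exact ⟨ε, h2, fun i => by simpa using h1 i⟩

theorem exists_lexOptimal {ι ν : Type*} [Fintype ι] [Fintype ν] (v : ι → ν → ℝ)
    (hv : ∀ i, 0 < v i) (q : ι → ℝ) {c₀ : ι → ℝ} (hc₀ : 0 ≤ c₀) :
    ∃ c : ι → ℝ, 0 ≤ c ∧ ∑ i, c i • v i = ∑ i, c₀ i • v i ∧ LexOptimal v q c := by
  set P : Set (ι → ℝ) := {c | 0 ≤ c ∧ ∑ i, c i • v i = ∑ i, c₀ i • v i} with hP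
  have hPclosed : IsClosed P := by
    refine IsClosed.inter isClosed_Ici (isClosed_eq ?_ continuous_const)
    fun_prop
  have hPcomp : IsCompact P := by
    choose k hk using fun i => (Pi.lt_def.1 (hv i)).2
    refine (isCompact_Icc (a := (0 : ι → ℝ))
      (b := fun i => (∑ j, c₀ j • v j) (k i) / v i (k i))).of_isClosed_subset hPclosed ?_
    rintro c ⟨hc0, hc⟩
    refine ⟨hc0, fun i => ?_⟩
    rw [le_div_iff₀ (hk i), ← hc]
    simp only [Finset.sum_apply, Pi.smul_apply, smul_eq_mul]
    exact single_le_sum (f := fun j => c j * v j (k i))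
      (fun j _ => mul_nonneg (hc0 j) ((hv j).le (k i))) (mem_univ i)
  obtain ⟨c₁, hc₁, hmax⟩ := hPcomp.exists_isMaxOn ⟨c₀, hc₀, rfl⟩
    (f := fun c => ∑ i, c i) (by fun_prop)
  have hQcomp : IsCompact (P ∩ {c | ∑ i, c i = ∑ i, c₁ i}) :=
    hPcomp.inter_right (isClosed_eq (by fun_prop) continuous_const)
  obtain ⟨c, ⟨hcP, hcs⟩, hmin⟩ := hQcomp.exists_isMinOn ⟨c₁, hc₁, rfl⟩
    (f := fun c => ∑ i, c i * q i) (by fun_prop)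
  refine ⟨c, hcP.1, hcP.2, fun a ha0 ha => ?_⟩
  obtain ⟨ε, hε, hnn⟩ := exists_pos_add_smul_nonneg hcP.1 ha
  have hmem : c + ε • a ∈ P := by
    refine ⟨hnn, ?_⟩
    simp only [Pi.add_apply, Pi.smul_apply, add_smul, smul_assoc, sum_add_distrib, ← smul_sum,
      ha0, smul_zero, add_zero, hcP.2]
  have hsum : ∑ i, (c + ε • a) i = ∑ i, c i + ε * ∑ i, a i := by
    simp [sum_add_distrib, mul_sum]
  have hsumq : ∑ i, (c + ε • a) i * q i = ∑ i, c i * q i + ε * ∑ i, a i * q i := by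
    simp [sum_add_distrib, mul_sum, add_mul, mul_assoc]
  refine ⟨?_, fun hz => ?_⟩
  · have h1 : ∑ i, (c + ε • a) i ≤ ∑ i, c₁ i := hmax hmem
    have hcs' : ∑ i, c i = ∑ i, c₁ i := hcs
    by_contra! hlt
    have := mul_pos hε hlt
    linarith
  · have h1 : ∑ i, c i * q i ≤ ∑ i, (c + ε • a) i * q i := by
      refine hmin ⟨hmem, ?_⟩
      rw [Set.mem_ofPred_eq, hsum, hz, mul_zero, add_zero]
      exact hcs
    by_contra! hlt
    have := mul_neg_of_pos_of_neg hε hlt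
    linarith

/-- A lexicographic optimum may be chosen with support no larger than the dimension. -/
theorem exists_lexOptimal_card_le {ι ν : Type*} [Fintype ι] [Fintype ν]
    (v : ι → ν → ℝ) (hv : ∀ i, 0 < v i) (q : ι → ℝ) {c₀ : ι → ℝ} (hc₀ : 0 ≤ c₀) :
    ∃ c : ι → ℝ, 0 ≤ c ∧ ∑ i, c i • v i = ∑ i, c₀ i • v i ∧ LexOptimal v q c ∧
      #{i | c i ≠ 0} ≤ Fintype.card ν := by
  classical
  have hex : ∃ m, ∃ c : ι → ℝ, 0 ≤ c ∧ ∑ i, c i • v i = ∑ i, c₀ i • v i ∧ LexOptimal v q c ∧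
      #{i | c i ≠ 0} = m := by
    obtain ⟨c, h1, h2, h3⟩ := exists_lexOptimal v hv q hc₀
    exact ⟨_, c, h1, h2, h3, rfl⟩
  obtain ⟨c, hc, hcd, hopt, hcard⟩ := Nat.find_spec hex
  refine ⟨c, hc, hcd, hopt, ?_⟩
  by_contra! hlt
  have hdep : ¬ LinearIndependent ℝ (fun i : {i // c i ≠ 0} => v i) := by
    intro hli
    have := hli.fintype_card_le_finrank
    rw [Fintype.card_subtype, Module.finrank_fintype_fun_eq_card] at this
    omega
  obtain ⟨b, hb, ⟨i₀, hi₀⟩, hbi⟩ := Fintype.not_linearIndependent_iff.1 hdep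
  set a : ι → ℝ := fun i => if h : c i ≠ 0 then b ⟨i, h⟩ else 0 with ha
  have ha0 : ∀ i, c i = 0 → a i = 0 := fun i hi => by simp [ha, hi]
  have hav : ∑ i, a i • v i = 0 := by
    rw [← hb, ← sum_filter_of_ne (p := fun i => c i ≠ 0)
      (fun i _ h hi => h (by rw [ha0 i hi, zero_smul])),
      sum_subtype (p := fun i => c i ≠ 0) _ (by simp)]
    exact sum_congr rfl fun i _ => by simp [ha, i.2]
  have hane : ∃ i, a i ≠ 0 := ⟨i₀, by simpa [ha, hi₀] using hbi⟩
  have hplus := hopt a hav fun i hi => (ha0 i hi).ge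
  have hminus := hopt (-a) (by simp [hav]) fun i hi => by simp [ha0 i hi]
  have hsum : ∑ i, a i = 0 := by
    have := hminus.1
    simp only [Pi.neg_apply, sum_neg_distrib] at this
    linarith [hplus.1]
  obtain ⟨p, hp⟩ : ∃ i, 0 < a i := by
    by_contra! hneg
    obtain ⟨i, hi⟩ := hane
    exact hi ((sum_eq_zero_iff_of_nonpos fun i _ => hneg i).1 hsum i (mem_univ i))
  obtain ⟨j, hj, hjmin⟩ := exists_min_image {i | 0 < a i} (fun i => c i / a i) ⟨p, by simpa⟩
  have hj : 0 < a j := by simpa using hj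
  set θ := c j / a j
  have hθ : 0 ≤ θ := div_nonneg (hc j) hj.le
  have hzero : ∀ i, c i = 0 → c i - θ * a i = 0 := fun i hi => by simp [hi, ha0 i hi]
  have hcj : c j ≠ 0 := fun h => hj.ne' (ha0 j h)
  have hjz : c j - θ * a j = 0 := by simp [θ, hj.ne']
  refine Nat.find_min hex (m := #{i | c i - θ * a i ≠ 0}) ?_
    ⟨fun i => c i - θ * a i, ?_, ?_, ?_, rfl⟩
  · rw [← hcard]
    refine card_lt_card (ssubset_iff_of_subset ?_ |>.2 ⟨j, by simpa using hcj, by simpa using hjz⟩)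
    intro i
    simp only [mem_filter, mem_univ, true_and]
    exact mt (hzero i)
  · intro i
    simp only [Pi.zero_apply, sub_nonneg]
    rcases le_or_gt (a i) 0 with h | h
    · exact (mul_nonpos_of_nonneg_of_nonpos hθ h).trans (hc i)
    · exact (le_div_iff₀ h).1 (hjmin i (by simpa))
  · simp only [sub_smul, sum_sub_distrib, mul_smul, ← smul_sum, hav, hcd, smul_zero, sub_zero]
  · exact fun e he hei => hopt e he fun i hi => hei i (hzero i hi)

/-- Sebő's integer Carathéodory bound: a nonnegative vector in a subgroup of `ℤ^ν` is a positive
integer combination of at most `2 |ν| - 2` minimal positive elements of the subgroup. -/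
theorem exists_sum_minimal_card_le {ν : Type*} [Fintype ν] (hν : 2 ≤ Fintype.card ν)
    (M : AddSubgroup (ν → ℤ)) {d : ν → ℤ} (hdM : d ∈ M) (hd : 0 ≤ d) :
    ∃ (S : Finset (ν → ℤ)) (c : (ν → ℤ) → ℕ), #S ≤ 2 * Fintype.card ν - 2 ∧
      (∀ h ∈ S, 0 < c h ∧ Minimal (fun h => h ∈ M ∧ 0 < h) h) ∧ ∑ h ∈ S, c h • h = d := by
  classical
  set H : Set (ν → ℤ) := {h | Minimal (fun h => h ∈ M ∧ 0 < h) h ∧ h ≤ d} with hH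
  have hHfin : H.Finite := (Set.finite_Icc 0 d).subset fun h hh => ⟨hh.1.prop.2.le, hh.2⟩
  have : Fintype H := hHfin.fintype
  have hrep : ∀ z ∈ M, 0 ≤ z → z ≤ d → ∃ c : H → ℕ, ∑ i, c i • (i : ν → ℤ) = z := by
    intro z hz h0 hzd
    have := mem_span_minimal M d z hz h0 hzd
    rwa [← hH, ← Subtype.range_coe (s := H), Submodule.mem_span_range_iff_exists_fun] at this
  suffices hmain : ∃ c : H → ℕ, #{i | c i ≠ 0} ≤ 2 * Fintype.card ν - 2 ∧
      ∑ i, c i • (i : ν → ℤ) = d by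
    obtain ⟨c, hcard, hsum⟩ := hmain
    refine ⟨({i | c i ≠ 0} : Finset H).map ⟨Subtype.val, Subtype.val_injective⟩,
      fun h => if hh : h ∈ H then c ⟨h, hh⟩ else 0, by rwa [card_map], ?_, ?_⟩
    · simp only [mem_map, mem_filter, mem_univ, true_and, Function.Embedding.coeFn_mk]
      rintro _ ⟨i, hi, rfl⟩
      exact ⟨by simpa using Nat.pos_of_ne_zero hi, i.2.1⟩
    · rw [sum_map]
      refine (sum_congr rfl fun i _ => ?_).trans ((sum_filter_of_ne (p := fun i => c i ≠ 0)
        (fun i _ h hi => h (by rw [hi, zero_smul]))).trans hsum)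
      simp
  set v : H → ν → ℝ := fun i k => ((i : ν → ℤ) k : ℝ) with hv
  have hvpos : ∀ i, 0 < v i := by
    intro i
    obtain ⟨h0, k, hk⟩ := Pi.lt_def.1 i.2.1.prop.2
    exact Pi.lt_def.2 ⟨fun k => by simpa [hv] using h0 k, k, by simpa [hv] using hk⟩
  have hvk : ∀ i k, 0 ≤ v i k := fun i => (hvpos i).le
  obtain ⟨c₀, hc₀⟩ := hrep d hdM hd le_rfl
  obtain ⟨c, hc, hcd, hopt, hcard⟩ := exists_lexOptimal_card_le v hvpos (fun i => ∑ k, v i k ^ 2)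
    (c₀ := fun i => (c₀ i : ℝ)) (fun i => by simp)
  have hcd' : ∀ k, ∑ i, c i * v i k = d k := by
    intro k
    have h1 := congrFun hcd k
    simp only [Finset.sum_apply, Pi.smul_apply, smul_eq_mul] at h1
    rw [h1, ← hc₀]
    simp [hv]
  set f : H → ℕ := fun i => ⌊c i⌋₊ with hf
  set r : H → ℝ := fun i => c i - f i with hr
  have hr0 : ∀ i, 0 ≤ r i := fun i => sub_nonneg.2 (Nat.floor_le (hc i))
  have hr1 : ∀ i, r i < 1 := fun i => by
    have := Nat.lt_floor_add_one (c i)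
    simp only [hr, hf]; linarith
  have hrz : ∀ i, c i = 0 → r i = 0 := fun i hi => by simp [hr, hf, hi]
  set z : ν → ℤ := d - ∑ i, f i • (i : ν → ℤ) with hz
  have hzr : ∀ k, (z k : ℝ) = ∑ i, r i * v i k := by
    intro k
    simp [hz, hr, sub_mul, ← hcd', hv]
  have hzM : z ∈ M := M.sub_mem hdM (M.sum_mem fun i _ => M.nsmul_mem i.2.1.prop.1 _)
  have hz0 : 0 ≤ z := by
    intro k
    have : (0 : ℝ) ≤ z k := by
      rw [hzr]; exact sum_nonneg fun i _ => mul_nonneg (hr0 i) (hvk i k)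
    exact_mod_cast this
  have hFnn : (0 : ν → ℤ) ≤ ∑ i, f i • (i : ν → ℤ) :=
    sum_nonneg fun i _ => nsmul_nonneg i.2.1.prop.2.le _
  obtain ⟨m, hm⟩ := hrep z hzM hz0 (sub_le_self _ hFnn)
  have hmr : ∀ k, ∑ i, (m i : ℝ) * v i k = z k := by
    intro k
    rw [← hm]; simp [hv]
  set S : Finset H := {i | c i ≠ 0} with hS
  have hmS : ∑ i, (m i : ℝ) ≤ ∑ i ∈ S, r i := by
    have := (hopt (fun i => m i - r i) (by
      ext k
      simp [sub_mul, hmr, hzr]) (fun i hi => by simp [hrz i hi])).1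
    rw [sum_sub_distrib, sub_nonpos] at this
    rwa [hS, sum_filter_of_ne (p := fun i => c i ≠ 0) fun i _ h hi => h (hrz i hi)]
  refine ⟨fun i => f i + m i, ?_, ?_⟩
  swap
  · simp only [add_smul, sum_add_distrib, hm, hz]
    abel
  by_contra! hlt
  set F : Finset H := {i | f i ≠ 0} with hF
  have hFS : F ⊆ S := by
    intro i
    simp only [hF, hS, hf, mem_filter, mem_univ, true_and]
    exact mt fun hi => by simp [hi]
  have hcount : #{i | f i + m i ≠ 0} ≤ #F + ∑ i, m i := by
    have h1 : ({i | f i + m i ≠ 0} : Finset H) ⊆ F ∪ ({i | m i ≠ 0} : Finset H) := by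
      intro i; simp only [hF, mem_filter, mem_univ, true_and, mem_union]; omega
    have h2 : #({i | m i ≠ 0} : Finset H) ≤ ∑ i, m i := by
      rw [card_eq_sum_ones, sum_filter]
      exact sum_le_sum fun i _ => by split_ifs <;> omega
    exact (card_le_card h1).trans ((card_union_le _ _).trans (by omega))
  have hSne : S.Nonempty := by
    by_contra hne
    rw [not_nonempty_iff_eq_empty] at hne
    rw [hne, sum_empty] at hmS
    have : ∑ i, m i ≤ 0 := by exact_mod_cast hmS
    rw [hne, subset_empty] at hFS
    rw [hFS, card_empty] at hcount
    omega
  have hmlt : ∑ i, m i < #S := by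
    have : ∑ i ∈ S, r i < #S := by
      simpa using sum_lt_sum_of_nonempty hSne (f := r) (g := fun _ => (1 : ℝ)) fun i _ => hr1 i
    exact_mod_cast hmS.trans_lt this
  have hFcard := card_le_card hFS
  have hFSeq : F = S := eq_of_subset_of_card_le hFS (by omega)
  have hSN : #S = Fintype.card ν := by omega
  have hmN : ∑ i, m i + 1 = #S := by omega
  set y : ν → ℤ := ∑ i ∈ S, (i : ν → ℤ) - z with hy
  have hyr : ∀ k, (y k : ℝ) = ∑ i ∈ S, (1 - r i) * v i k := by
    intro k
    have h1 : ∑ i, r i * v i k = ∑ i ∈ S, r i * v i k :=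
      (sum_filter_of_ne (p := fun i => c i ≠ 0)
        fun i _ h hi => h (by rw [hrz i hi, zero_mul])).symm
    simp only [hy, Pi.sub_apply, Int.cast_sub, hzr, h1, sub_mul, sum_sub_distrib, one_mul]
    simp [hv]
  have hyM : y ∈ M := M.sub_mem (M.sum_mem fun i _ => i.2.1.prop.1) hzM
  have hypos : ∀ i k, i ∈ S → 0 < v i k → 0 < y k := by
    intro i k hi hik
    have : (0 : ℝ) < y k := by
      rw [hyr]
      exact sum_pos' (fun j _ => mul_nonneg (sub_nonneg.2 (hr1 j).le) (hvk j k))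
        ⟨i, hi, mul_pos (sub_pos.2 (hr1 i)) hik⟩
    exact_mod_cast this
  have hy0 : 0 ≤ y := by
    intro k
    have : (0 : ℝ) ≤ y k := by
      rw [hyr]; exact sum_nonneg fun i _ => mul_nonneg (sub_nonneg.2 (hr1 i).le) (hvk i k)
    exact_mod_cast this
  have hyd : y ≤ d := by
    have h1 : ∑ i ∈ S, (i : ν → ℤ) ≤ ∑ i, f i • (i : ν → ℤ) := by
      rw [← sum_filter_of_ne (s := univ) (p := fun i => f i ≠ 0)
        (fun i _ h hi => h (by rw [hi, zero_smul])), ← hF, hFSeq]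
      refine sum_le_sum fun i hi => ?_
      rw [← hFSeq, hF, mem_filter] at hi
      exact le_self_nsmul i.2.1.prop.2.le hi.2
    calc y ≤ ∑ i ∈ S, (i : ν → ℤ) := sub_le_self _ hz0
      _ ≤ _ := h1
      _ ≤ d := sub_nonneg.1 hz0
  obtain ⟨p, hp⟩ := hrep y hyM hy0 hyd
  have hpr : ∀ k, ∑ i, (p i : ℝ) * v i k = y k := by
    intro k
    rw [← hp]; simp [hv]
  have hpone : 1 ≤ ∑ i, p i := by
    rw [Nat.one_le_iff_ne_zero]
    intro h0
    rw [sum_eq_zero_iff] at h0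
    obtain ⟨i, hi⟩ := hSne
    obtain ⟨-, k, hk⟩ := Pi.lt_def.1 (hvpos i)
    have := hypos i k hi hk
    rw [← hp] at this
    simp [h0] at this
  have hrS : ∑ i ∈ S, (1 - r i) ≤ 1 := by
    have h1 : (∑ i, (m i : ℝ)) + 1 = #S := by exact_mod_cast hmN
    rw [sum_sub_distrib, sum_const, nsmul_one]
    linarith
  set s : H → ℝ := fun i => if i ∈ S then 1 - r i else 0 with hs
  have hsS : ∀ g : H → ℝ, ∑ i, s i * g i = ∑ i ∈ S, (1 - r i) * g i := by
    intro g
    simp [hs, ite_mul, sum_ite_mem]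
  have hs1 : ∑ i, s i = ∑ i ∈ S, (1 - r i) := by simpa using hsS 1
  have hdir := hopt (fun i => p i - s i) (by
      ext k
      simp [sub_mul, hpr, hyr, hsS]) (fun i hi => by simp [hs, hS, hi])
  rw [sum_sub_distrib, hs1] at hdir
  have hp1' : (1 : ℝ) ≤ ∑ i, (p i : ℝ) := by exact_mod_cast hpone
  have hrS1 : ∑ i ∈ S, (1 - r i) = 1 := by linarith [hdir.1]
  have hp1 : ∑ i, p i = 1 := by
    have : ∑ i, (p i : ℝ) ≤ 1 := by linarith [hdir.1]
    exact le_antisymm (by exact_mod_cast this) hpone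
  obtain ⟨j, hj⟩ : ∃ j, p = Pi.single j 1 := by
    obtain ⟨j, hj⟩ : ∃ j, p j ≠ 0 := by
      by_contra! h
      simp [h] at hp1
    refine ⟨j, funext fun i => ?_⟩
    have h1 := add_sum_erase univ p (mem_univ j)
    rcases eq_or_ne i j with rfl | hij
    · rw [Pi.single_eq_same]; omega
    · rw [Pi.single_eq_of_ne hij]
      have := single_le_sum (f := p) (fun _ _ => Nat.zero_le _) (mem_erase.2 ⟨hij, mem_univ i⟩)
      omega
  have hpv : ∀ g : H → ℝ, ∑ i, (p i : ℝ) * g i = g j := by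
    intro g
    rw [sum_eq_single j (fun i _ hij => by simp [hj, hij]) (by simp)]
    simp [hj]
  have hconv : ∀ k, ∑ i ∈ S, (1 - r i) * v i k = v j k := fun k => by
    rw [← hyr, ← hpr, hpv]
  have hq := hdir.2 (by rw [hrS1, sub_eq_zero]; exact_mod_cast hp1)
  simp only [sub_mul, sum_sub_distrib, hpv, hsS] at hq
  have hvar : ∑ i ∈ S, (1 - r i) * ∑ k, (v i k - v j k) ^ 2 ≤ 0 := by
    have hexp : ∀ i, (1 - r i) * ∑ k, (v i k - v j k) ^ 2 =
        (1 - r i) * ∑ k, v i k ^ 2 - 2 * ∑ k, ((1 - r i) * v i k) * v j k +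
          (1 - r i) * ∑ k, v j k ^ 2 := by
      intro i
      simp only [mul_sum, ← sum_sub_distrib, ← sum_add_distrib]
      exact sum_congr rfl fun k _ => by ring
    have hcross : ∑ i ∈ S, ∑ k, ((1 - r i) * v i k) * v j k = ∑ k, v j k ^ 2 := by
      rw [sum_comm]
      exact sum_congr rfl fun k _ => by rw [← sum_mul, hconv, sq]
    simp only [hexp, sum_add_distrib, sum_sub_distrib, ← mul_sum S, ← sum_mul, hrS1, hcross]
    simp only [sub_mul, sum_sub_distrib]
    linarith
  have hall : ∀ i ∈ S, i = j := by
    have hnn : ∀ i ∈ S, 0 ≤ (1 - r i) * ∑ k, (v i k - v j k) ^ 2 := fun i _ =>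
      mul_nonneg (sub_nonneg.2 (hr1 i).le) (sum_nonneg fun k _ => sq_nonneg _)
    intro i hi
    have h1 := (sum_eq_zero_iff_of_nonneg hnn).1 (le_antisymm hvar (sum_nonneg hnn)) i hi
    have h2 := (mul_eq_zero.1 h1).resolve_left (sub_pos.2 (hr1 i)).ne'
    refine Subtype.ext (funext fun k => ?_)
    have h3 := (sum_eq_zero_iff_of_nonneg fun k _ => sq_nonneg _).1 h2 k (mem_univ k)
    have h4 : v i k = v j k := sub_eq_zero.1 (pow_eq_zero_iff two_ne_zero |>.1 h3)
    simpa [hv] using h4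
  have : #S ≤ 1 := card_le_one.2 fun a ha b hb => (hall a ha).trans (hall b hb).symm
  omega

end Caratheodory

section Graver

open Finset

theorem conformalLe_mul_iff {ν : Type*} {σ y h : ν → ℤ} (hσ : ∀ k, σ k = 1 ∨ σ k = -1)
    (hh : 0 ≤ h) : ConformalLe y (σ * h) ↔ 0 ≤ σ * y ∧ σ * y ≤ h := by
  simp only [ConformalLe, Pi.le_def, ← forall_and]
  refine forall_congr' fun k => ?_
  have h0 : 0 ≤ h k := hh k
  simp only [Pi.mul_apply, Pi.zero_apply]
  have key : ∀ a : ℤ, 0 ≤ a * h k ∧ |a| ≤ |h k| ↔ 0 ≤ a ∧ a ≤ h k := by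
    intro a
    rw [abs_of_nonneg h0, abs_le]
    constructor
    · rintro ⟨h1, h2, h3⟩
      refine ⟨?_, h3⟩
      by_contra! hneg
      nlinarith
    · rintro ⟨h1, h2⟩
      exact ⟨mul_nonneg h1 h0, by omega, h2⟩
  rcases hσ k with hk | hk <;> rw [hk, ← key] <;> simp

/-- Every integer point of the kernel of `A` is a conformal sum of positive multiples of at most
`2 |ν| - 2` elements of the Graver basis. -/
theorem exists_conformal_graver_sum {μ ν : Type*} [Fintype ν] (hν : 2 ≤ Fintype.card ν)
    (A : Matrix μ ν ℤ) {d : ν → ℤ} (hd : A.mulVec d = 0) :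
    ∃ (S : Finset (ν → ℤ)) (c : (ν → ℤ) → ℕ), #S ≤ 2 * Fintype.card ν - 2 ∧
      (∀ h ∈ S, 0 < c h ∧ h ∈ GraverBasis A ∧ ConformalLe ((c h : ℤ) • h) d) ∧
      ∑ h ∈ S, (c h : ℤ) • h = d := by
  set σ : ν → ℤ := fun k => if 0 ≤ d k then 1 else -1 with hσdef
  have hσ : ∀ k, σ k = 1 ∨ σ k = -1 := fun k => by
    by_cases h : 0 ≤ d k <;> simp [hσdef, h]
  have hσσ : ∀ y, σ * (σ * y) = y := fun y => by
    ext k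
    rcases hσ k with h | h <;> simp [h]
  have hσd : 0 ≤ σ * d := by
    intro k
    by_cases h : 0 ≤ d k
    · simp [hσdef, h]
    · simp only [hσdef, Pi.mul_apply, h, Pi.zero_apply, if_false]
      omega
  set M : AddSubgroup (ν → ℤ) :=
    (LinearMap.ker (A.mulVecLin ∘ₗ LinearMap.mulLeft ℤ σ)).toAddSubgroup
  have hM : ∀ y, y ∈ M ↔ A.mulVec (σ * y) = 0 := fun y => by simp [M]
  obtain ⟨S, c, hS, hmin, hsum⟩ := exists_sum_minimal_card_le hν M (d := σ * d)
    ((hM _).2 (by rwa [hσσ])) hσd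
  have hinj : Function.Injective (fun y => σ * y) :=
    Function.LeftInverse.injective (g := fun y => σ * y) hσσ
  refine ⟨S.map ⟨_, hinj⟩, fun h => c (σ * h), by rwa [card_map], ?_, ?_⟩
  · simp only [mem_map, Function.Embedding.coeFn_mk]
    rintro _ ⟨h, hh, rfl⟩
    obtain ⟨hc, hm⟩ := hmin h hh
    rw [hσσ]
    refine ⟨hc, ⟨(hM h).1 hm.prop.1, ?_, ?_⟩, ?_⟩
    · intro h0
      exact hm.prop.2.ne' (hinj (by simpa using h0))
    · intro y hy hy0 hyh
      obtain ⟨h1, h2⟩ := (conformalLe_mul_iff hσ hm.prop.2.le).1 hyh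
      have hne : 0 ≠ σ * y := fun h0 => hy0 (by rw [← hσσ y, ← h0, mul_zero])
      have := hm.eq_of_le ⟨(hM _).2 (by rwa [hσσ]), h1.lt_of_ne hne⟩ h2
      rw [← this, hσσ]
    · have h1 : 0 ≤ c h • h := nsmul_nonneg hm.prop.2.le _
      have h2 : c h • h ≤ σ * d := by
        rw [← hsum]
        exact single_le_sum (f := fun h => c h • h)
          (fun i hi => nsmul_nonneg (hmin i hi).2.prop.2.le _) hh
      have := (conformalLe_mul_iff (y := (c h : ℤ) • (σ * h)) hσ hσd).2
      rw [hσσ, mul_smul_comm, hσσ, natCast_zsmul] at this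
      simpa using this ⟨h1, h2⟩
  · rw [sum_map, ← hσσ d, ← hsum, mul_sum]
    refine sum_congr rfl fun h _ => ?_
    simp only [Function.Embedding.coeFn_mk, hσσ, natCast_zsmul, mul_smul_comm]

theorem ConformalLe.add_mem_bounds {ν : Type*} {l u x y h : ν → ℤ} (hh : ConformalLe h (y - x))
    (hxl : l ≤ x) (hxu : x ≤ u) (hyl : l ≤ y) (hyu : y ≤ u) : l ≤ x + h ∧ x + h ≤ u := by
  refine ⟨fun k => ?_, fun k => ?_⟩ <;>
  · have h1 := hxl k
    have h2 := hxu k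
    have h3 := hyl k
    have h4 := hyu k
    obtain ⟨h5, h6⟩ := hh k
    simp only [Pi.sub_apply, Pi.add_apply] at *
    rcases le_total 0 (y k - x k) with h7 | h7
    · have h8 : 0 ≤ h k ∨ y k - x k = 0 := by
        by_contra! hc
        have : 0 < y k - x k := by omega
        nlinarith
      rw [abs_of_nonneg h7, abs_le] at h6
      omega
    · have h8 : h k ≤ 0 ∨ y k - x k = 0 := by
        by_contra! hc
        have : y k - x k < 0 := by omega
        nlinarith
      rw [abs_of_nonpos h7, abs_le] at h6
      omega

end Graver

/-- If `nt ≥ 2`, `x` is feasible, `x*` is optimal, and `γ g` is a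
Graver-best step for `x`, then the improvement of the Graver-best step is at least a
`1/(2(nt−1))` fraction of the best possible improvement:
`w·(x+γg) − w·x ≤ (w·x* − w·x) / (2(nt−1))`. -/
theorem graver_best_step_improvement {r s t n : ℕ}
    (A1 : Matrix (Fin r) (Fin t) ℤ) (A2 : Matrix (Fin s) (Fin t) ℤ)
    (hnt : 2 ≤ n * t)
    (w l u : Fin n × Fin t → ℤ) (b : Fin r ⊕ Fin n × Fin s → ℤ)
    (x : Fin n × Fin t → ℤ)
    (hxb : (nFold A1 A2 (Fin n)).mulVec x = b) (hxl : l ≤ x) (hxu : x ≤ u)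
    (xstar : Fin n × Fin t → ℤ)
    (hsb : (nFold A1 A2 (Fin n)).mulVec xstar = b) (hsl : l ≤ xstar)
    (hsu : xstar ≤ u)
    (hsopt : ∀ y : Fin n × Fin t → ℤ, (nFold A1 A2 (Fin n)).mulVec y = b →
      l ≤ y → y ≤ u → w ⬝ᵥ xstar ≤ w ⬝ᵥ y)
    (γ : ℕ) (g : Fin n × Fin t → ℤ) (hγ : 0 < γ)
    (hker : (nFold A1 A2 (Fin n)).mulVec g = 0)
    (hgl : l ≤ x + (γ : ℤ) • g) (hgu : x + (γ : ℤ) • g ≤ u)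
    (haug : w ⬝ᵥ ((γ : ℤ) • g) ≤ 0)
    (hbest : ∀ (γbar : ℕ), 0 < γbar → ∀ gbar ∈ GraverBasis (nFold A1 A2 (Fin n)),
      l ≤ x + (γbar : ℤ) • gbar → x + (γbar : ℤ) • gbar ≤ u →
      w ⬝ᵥ (x + (γ : ℤ) • g) ≤ w ⬝ᵥ (x + (γbar : ℤ) • gbar)) :
    ((w ⬝ᵥ (x + (γ : ℤ) • g) - w ⬝ᵥ x : ℤ) : ℚ) ≤
      ((w ⬝ᵥ xstar - w ⬝ᵥ x : ℤ) : ℚ) / (2 * ((n * t : ℚ) - 1)) := by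
  have hν : Fintype.card (Fin n × Fin t) = n * t := by simp
  obtain ⟨S, c, hS, hc, hsum⟩ := exists_conformal_graver_sum (by rwa [hν])
    (nFold A1 A2 (Fin n)) (d := xstar - x) (by rw [Matrix.mulVec_sub, hsb, hxb, sub_self])
  rw [hν] at hS
  have hstep : ∀ h ∈ S, w ⬝ᵥ ((γ : ℤ) • g) ≤ w ⬝ᵥ ((c h : ℤ) • h) := by
    intro h hh
    obtain ⟨hc0, hG, hconf⟩ := hc h hh
    obtain ⟨h1, h2⟩ := hconf.add_mem_bounds hxl hxu hsl hsu
    have := hbest (c h) hc0 h hG h1 h2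
    rwa [dotProduct_add, dotProduct_add, add_le_add_iff_left] at this
  have htotal : (S.card : ℤ) * (w ⬝ᵥ ((γ : ℤ) • g)) ≤ w ⬝ᵥ xstar - w ⬝ᵥ x := by
    rw [← dotProduct_sub, ← hsum, dotProduct_sum, ← nsmul_eq_mul]
    exact Finset.card_nsmul_le_sum _ _ _ hstep
  have hnt' : (2 : ℚ) ≤ n * t := by exact_mod_cast hnt
  rw [dotProduct_add, add_sub_cancel_left, le_div_iff₀ (by linarith)]
  have hScard : (S.card : ℤ) ≤ 2 * (n * t - 1) := by
    have : S.card + 2 ≤ 2 * (n * t) := by omega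
    have : (S.card : ℤ) + 2 ≤ 2 * (n * t) := by exact_mod_cast this
    linarith
  have hfinal : w ⬝ᵥ ((γ : ℤ) • g) * (2 * ((n * t : ℤ) - 1)) ≤ w ⬝ᵥ xstar - w ⬝ᵥ x := by
    refine le_trans ?_ htotal
    rw [mul_comm]
    exact mul_le_mul_of_nonpos_right hScard haug
  exact_mod_cast hfinal
end
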